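/- arXiv:2301.03104 — 2 statements merged into one kernel-verified Lean document; each statement's English description precedes it below -/
import Mathlib

section
/- Let (a; c₁, c₂, c₃, c₄) ∈ ℤ⁵ be such that c₁ ≥ c₂ ≥ c₃ ≥ c₄ ≥ 0, a ≥ c₁ + c₂ + 3, and a² − 6a + 4 = c₁² + c₂² + c₃² + c₄². Then (a; c₁, c₂, c₃, c₄) is one of (6; 2, 0, 0, 0), (6; 1, 1, 1, 1), (7; 3, 1, 1, 0), (9; 3, 3, 3, 2). -/
/-- Distinct integers `0 ≤ y < x` have squares differing by at least `2 * x - 1`. -/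
theorem two_mul_sub_one_le_sq_sub_sq {x y : ℤ} (hy : 0 ≤ y) (hyx : y < x) :
    2 * x - 1 ≤ x ^ 2 - y ^ 2 := by
  nlinarith

theorem stmt_0 (a c₁ c₂ c₃ c₄ : ℤ)
    (h₁ : c₁ ≥ c₂) (h₂ : c₂ ≥ c₃) (h₃ : c₃ ≥ c₄) (h₄ : c₄ ≥ 0)
    (ha : a ≥ c₁ + c₂ + 3)
    (heq : a ^ 2 - 6 * a + 4 = c₁ ^ 2 + c₂ ^ 2 + c₃ ^ 2 + c₄ ^ 2) :
    (a, c₁, c₂, c₃, c₄) = (6, 2, 0, 0, 0) ∨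
    (a, c₁, c₂, c₃, c₄) = (6, 1, 1, 1, 1) ∨
    (a, c₁, c₂, c₃, c₄) = (7, 3, 1, 1, 0) ∨
    (a, c₁, c₂, c₃, c₄) = (9, 3, 3, 3, 2) := by
  obtain ⟨k, hk, rfl⟩ : ∃ k : ℤ, 0 ≤ k ∧ a = c₁ + c₂ + 3 + k :=
    ⟨a - (c₁ + c₂ + 3), by omega, by ring⟩
  have key : 2 * (c₂ * (c₁ - c₂)) + (c₂ ^ 2 - c₃ ^ 2) + (c₂ ^ 2 - c₄ ^ 2)
      + 2 * (k * (c₁ + c₂)) + k ^ 2 = 5 := by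
    linear_combination heq
  have h0 : 0 ≤ c₂ * (c₁ - c₂) := mul_nonneg (by omega) (by omega)
  have h3 : 0 ≤ c₂ ^ 2 - c₃ ^ 2 := by nlinarith
  have h4 : 0 ≤ c₂ ^ 2 - c₄ ^ 2 := by nlinarith
  have hk0 : 0 ≤ k * (c₁ + c₂) := mul_nonneg hk (by omega)
  have hk2 : k ≤ 2 := by nlinarith
  have hc2 : c₂ ≤ 3 := by
    by_contra! hlt
    have hc₃ : c₃ = c₂ := by
      by_contra hne
      have := two_mul_sub_one_le_sq_sub_sq (x := c₂) (y := c₃) (by omega) (by omega)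
      linarith [sq_nonneg k]
    have hc₄ : c₄ = c₂ := by
      by_contra hne
      have := two_mul_sub_one_le_sq_sub_sq (x := c₂) (y := c₄) (by omega) (by omega)
      linarith [sq_nonneg k]
    have hk : k = 0 := by
      by_contra hne
      have : c₁ + c₂ ≤ k * (c₁ + c₂) := le_mul_of_one_le_left (by omega) (by omega)
      linarith [sq_nonneg k]
    rw [hc₃, hc₄, hk] at key
    omega
  have hc2' : 0 ≤ c₂ := by omega
  have hc3' : 0 ≤ c₃ := by omega
  have hc3 : c₃ ≤ 3 := by omega
  have hc4 : c₄ ≤ 3 := by omega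
  clear heq h0 h3 h4 hk0
  simp only [Prod.mk.injEq]
  interval_cases c₂ <;> interval_cases c₃ <;> interval_cases c₄ <;> interval_cases k <;> omega
end

section
/- Let (a; b₁, b₂, b₃, b₄, b₅, b₆) ∈ ℤ⁷ with b₁ ≥ b₂ ≥ b₃ ≥ b₄ ≥ b₅ ≥ b₆, satisfying a² − (b₁² + b₂² + b₃² + b₄² + b₅² + b₆²) = 10 and 3a − (b₁ + b₂ + b₃ + b₄ + b₅ + b₆) = 6. Then (a; b₁, …, b₆) is one of (4; 1,1,1,1,1,1), (5; 2,2,2,1,1,1), (6; 3,2,2,2,2,1), (7; 3,3,3,2,2,2), (8; 3,3,3,3,3,3). -/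
theorem stmt_1 (a b₁ b₂ b₃ b₄ b₅ b₆ : ℤ)
    (h₁ : b₁ ≥ b₂) (h₂ : b₂ ≥ b₃) (h₃ : b₃ ≥ b₄) (h₄ : b₄ ≥ b₅) (h₅ : b₅ ≥ b₆)
    (heq1 : a ^ 2 - (b₁ ^ 2 + b₂ ^ 2 + b₃ ^ 2 + b₄ ^ 2 + b₅ ^ 2 + b₆ ^ 2) = 10)
    (heq2 : 3 * a - (b₁ + b₂ + b₃ + b₄ + b₅ + b₆) = 6) :
    (a, b₁, b₂, b₃, b₄, b₅, b₆) = (4, 1, 1, 1, 1, 1, 1) ∨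
    (a, b₁, b₂, b₃, b₄, b₅, b₆) = (5, 2, 2, 2, 1, 1, 1) ∨
    (a, b₁, b₂, b₃, b₄, b₅, b₆) = (6, 3, 2, 2, 2, 2, 1) ∨
    (a, b₁, b₂, b₃, b₄, b₅, b₆) = (7, 3, 3, 3, 2, 2, 2) ∨
    (a, b₁, b₂, b₃, b₄, b₅, b₆) = (8, 3, 3, 3, 3, 3, 3) := by
  -- The mean of the `bᵢ` is `(a - 2) / 2`, and this is four times their total squared deviation.
  have hdev : (2 * b₁ - a + 2) ^ 2 + (2 * b₂ - a + 2) ^ 2 + (2 * b₃ - a + 2) ^ 2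
      + (2 * b₄ - a + 2) ^ 2 + (2 * b₅ - a + 2) ^ 2 + (2 * b₆ - a + 2) ^ 2
      = 8 - 2 * (a - 6) ^ 2 := by
    linear_combination (-4) * heq1 + 4 * (a - 2) * heq2
  have ha : (a - 6) ^ 2 ≤ 2 ^ 2 := by
    linarith [sq_nonneg (2 * b₁ - a + 2), sq_nonneg (2 * b₂ - a + 2), sq_nonneg (2 * b₃ - a + 2),
      sq_nonneg (2 * b₄ - a + 2), sq_nonneg (2 * b₅ - a + 2), sq_nonneg (2 * b₆ - a + 2)]
  have hb₁ : (2 * b₁ - a + 2) ^ 2 < 3 ^ 2 := by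
    linarith [sq_nonneg (a - 6), sq_nonneg (2 * b₂ - a + 2), sq_nonneg (2 * b₃ - a + 2),
      sq_nonneg (2 * b₄ - a + 2), sq_nonneg (2 * b₅ - a + 2), sq_nonneg (2 * b₆ - a + 2)]
  have hb₆ : (2 * b₆ - a + 2) ^ 2 < 3 ^ 2 := by
    linarith [sq_nonneg (a - 6), sq_nonneg (2 * b₁ - a + 2), sq_nonneg (2 * b₂ - a + 2),
      sq_nonneg (2 * b₃ - a + 2), sq_nonneg (2 * b₄ - a + 2), sq_nonneg (2 * b₅ - a + 2)]
  obtain ⟨ha_lower, ha_upper⟩ := abs_le_of_sq_le_sq' ha (by norm_num)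
  have hb₁_upper := (abs_lt_of_sq_lt_sq' hb₁ (by norm_num)).2
  have hb₆_lower := (abs_lt_of_sq_lt_sq' hb₆ (by norm_num)).1
  clear hdev ha hb₁ hb₆
  have ha₄ : 4 ≤ a := by linarith
  have ha₈ : a ≤ 8 := by linarith
  have hb₁_le : b₁ ≤ a / 2 := by omega
  have hb₆_ge : (a - 3) / 2 ≤ b₆ := by omega
  have hb₅_ge := hb₆_ge.trans h₅
  have hb₄_ge := hb₅_ge.trans h₄
  have hb₃_ge := hb₄_ge.trans h₃
  have hb₂_ge := hb₃_ge.trans h₂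
  have hb₁_ge := hb₂_ge.trans h₁
  simp only [Prod.mk.injEq]
  interval_cases a <;> interval_cases b₁ <;> interval_cases b₂ <;> interval_cases b₃ <;>
    interval_cases b₄ <;> interval_cases b₅ <;> interval_cases b₆ <;> omega
end
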